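/- Let X ⊆ B(H) be a weak* closed D-bimodule and T ∈ B(H). Then the Arveson distance α(T,X) equals the supremum of ‖Φ(T)‖ over all contractive Schur idempotents Φ on B(H) satisfying Φ(X) = {0}. -/

import Mathlib

open scoped InnerProductSpace Pointwise

noncomputable section

namespace SchurHyper

/-- `B H` is the algebra of bounded linear operators on `H`. -/
abbrev B (H : Type*) [NormedAddCommGroup H] [InnerProductSpace ℂ H] : Type _ := H →L[ℂ] H

variable (H : Type*) [NormedAddCommGroup H] [InnerProductSpace ℂ H]

/-- A linear functional on `B H` is *normal* (weak* continuous) if it arises from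
the duality with the trace class, i.e. it is of the form
`T ↦ ∑ₙ ⟪yₙ, T xₙ⟫` for square-summable sequences `(xₙ)`, `(yₙ)`
(recall that the inner product is conjugate-linear in its first slot). -/
def IsNormalFunctional (ω : B H →ₗ[ℂ] ℂ) : Prop :=
  ∃ x y : ℕ → H, Summable (fun n => ‖x n‖ ^ 2) ∧ Summable (fun n => ‖y n‖ ^ 2) ∧
    ∀ T : B H, ω T = ∑' n, ⟪y n, T (x n)⟫_ℂ

/-- The weak* topology on `B H`: the topology induced by the normal functionals. -/
def weakStarTopology : TopologicalSpace (B H) :=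
  TopologicalSpace.induced
    (fun (T : B H) (ω : {ω : B H →ₗ[ℂ] ℂ // IsNormalFunctional H ω}) => ω.1 T)
    inferInstance

/-- A set of operators is weak* closed if it is closed in the weak* topology. -/
def WStarClosed (X : Set (B H)) : Prop := @IsClosed _ (weakStarTopology H) X

/-- The weak* closure of a set of operators. -/
def wStarClosure (X : Set (B H)) : Set (B H) := @closure _ (weakStarTopology H) X

/-- A map on `B H` is weak* continuous if it is continuous with respect to the
weak* topology on both sides. -/
def WStarContinuous (Φ : B H →L[ℂ] B H) : Prop :=
  @Continuous _ _ (weakStarTopology H) (weakStarTopology H) Φ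

variable {H}
variable [CompleteSpace H]

/-- A maximal abelian selfadjoint subalgebra of `B H`: an abelian selfadjoint
subalgebra which contains every operator commuting with it (equivalently, it
coincides with its own commutant). -/
def IsMasa (D : StarSubalgebra ℂ (B H)) : Prop :=
  (∀ A ∈ D, ∀ C ∈ D, A * C = C * A) ∧
  (∀ T : B H, (∀ A ∈ D, T * A = A * T) → T ∈ D)

/-- A Schur multiplier: a weak* continuous `D`-bimodule map on `B H`. -/
def IsSchurMultiplier (D : StarSubalgebra ℂ (B H)) (Φ : B H →L[ℂ] B H) : Prop :=
  WStarContinuous H Φ ∧ ∀ A ∈ D, ∀ C ∈ D, ∀ T : B H, Φ (A * T * C) = A * Φ T * C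

/-- A Schur idempotent: an idempotent Schur multiplier. -/
def IsSchurIdempotent (D : StarSubalgebra ℂ (B H)) (Φ : B H →L[ℂ] B H) : Prop :=
  IsSchurMultiplier D Φ ∧ Φ.comp Φ = Φ

/-- A subspace `X ⊆ B H` is a `D`-bimodule if `D X D ⊆ X`. -/
def IsBimodule (D : StarSubalgebra ℂ (B H)) (X : Submodule ℂ (B H)) : Prop :=
  ∀ A ∈ D, ∀ C ∈ D, ∀ T ∈ X, A * T * C ∈ X

/-- The Arveson distance `α(T, X)`. -/
def arveson (T : B H) (X : Set (B H)) : ℝ :=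
  ⨆ ξ : {ξ : H // ‖ξ‖ = 1}, ⨅ S : X, ‖T ξ.1 - S.1 ξ.1‖

/-- The set of hyperreflexivity constants of `X`. -/
def hyperSet (X : Set (B H)) : Set ℝ :=
  {k | 0 < k ∧ ∀ T : B H, Metric.infDist T X ≤ k * arveson T X}

/-- A subspace is hyperreflexive if `d(T, X) ≤ k ⬝ α(T, X)` for some `k > 0`. -/
def Hyperreflexive (X : Set (B H)) : Prop := (hyperSet X).Nonempty

/-- The hyperreflexivity constant `k(X)`: the least constant that works. -/
def hyperConst (X : Set (B H)) : ℝ := sInf (hyperSet X)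

/-- The set of constants `λ` witnessing that a Schur idempotent lies in `𝔉H`. -/
def lamSet (Φ : B H →L[ℂ] B H) : Set ℝ :=
  {l | 0 < l ∧ ∀ T : B H, ‖T - Φ T‖ ≤ l * arveson T (Set.range Φ)}

/-- The class `𝔉H` of Schur idempotents `Φ` such that
`‖T - Φ T‖ ≤ λ ⬝ α(T, ran Φ)` for some `λ > 0` and all `T`. -/
def MemFH (D : StarSubalgebra ℂ (B H)) (Φ : B H →L[ℂ] B H) : Prop :=
  IsSchurIdempotent D Φ ∧ (lamSet Φ).Nonempty

/-- The constant `λ(Φ)`: the least constant witnessing membership of `𝔉H`. -/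
def lam (Φ : B H →L[ℂ] B H) : ℝ := sInf (lamSet Φ)

/-- A ternary masa-bimodule condition: `S T* R ∈ M` whenever `S, T, R ∈ M`. -/
def IsTernary (M : Submodule ℂ (B H)) : Prop :=
  ∀ S ∈ M, ∀ T ∈ M, ∀ R ∈ M, S * star T * R ∈ M

end SchurHyper

namespace SchurHyper

open Filter Topology ContinuousLinearMap

variable {H : Type*} [NormedAddCommGroup H] [InnerProductSpace ℂ H] [CompleteSpace H]

/-- The closed subspace `closure (X ξ)`. -/
def orbit (X : Submodule ℂ (B H)) (ξ : H) : Submodule ℂ H :=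
  (X.map (apply ℂ H ξ : B H →ₗ[ℂ] H)).topologicalClosure

instance (X : Submodule ℂ (B H)) (ξ : H) : CompleteSpace (orbit X ξ) :=
  (Submodule.isClosed_topologicalClosure _).completeSpace_coe

omit [CompleteSpace H] in
lemma apply_mem_orbit {X : Submodule ℂ (B H)} {S : B H} (hS : S ∈ X) (ξ : H) :
    S ξ ∈ orbit X ξ :=
  Submodule.le_topologicalClosure _ ⟨S, hS, rfl⟩

omit [CompleteSpace H] in
/-- Closed conditions on `orbit X ξ` may be checked on the vectors `S ξ`, `S ∈ X`. -/
lemma orbit_induction {X : Submodule ℂ (B H)} {ξ : H} {p : H → Prop}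
    (hp : IsClosed {v | p v}) (h : ∀ S ∈ X, p (S ξ)) {v : H} (hv : v ∈ orbit X ξ) : p v := by
  have hv' : v ∈ closure ((X.map (apply ℂ H ξ : B H →ₗ[ℂ] H) : Submodule ℂ H) : Set H) := hv
  refine closure_minimal ?_ hp hv'
  rintro _ ⟨S, hS, rfl⟩
  exact h S hS

omit [CompleteSpace H] in
lemma orbit_invariant {X : Submodule ℂ (B H)} {A : B H} (hA : ∀ S ∈ X, A * S ∈ X) (ξ : H)
    {v : H} (hv : v ∈ orbit X ξ) : A v ∈ orbit X ξ :=
  orbit_induction (p := fun v => A v ∈ orbit X ξ)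
    ((Submodule.isClosed_topologicalClosure _).preimage A.continuous)
    (fun S hS => apply_mem_orbit (hA S hS) ξ) hv

lemma starProjection_mem_masa {D : StarSubalgebra ℂ (B H)} (hD : IsMasa D)
    (K : Submodule ℂ H) [K.HasOrthogonalProjection] (hK : ∀ A ∈ D, ∀ v ∈ K, A v ∈ K) :
    K.starProjection ∈ D := by
  refine hD.2 _ fun A hA => ContinuousLinearMap.ext fun v => ?_
  refine Submodule.eq_starProjection_of_mem_orthogonal
    (hK A hA _ (Submodule.starProjection_apply_mem _ _)) ?_
  rw [Submodule.mem_orthogonal]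
  intro w hw
  change ⟪w, A v - A (K.starProjection v)⟫_ℂ = 0
  rw [← map_sub, ← adjoint_inner_left, ← star_eq_adjoint]
  exact (Submodule.mem_orthogonal _ _).1 (Submodule.sub_starProjection_mem_orthogonal v) _
    (hK _ (star_mem hA) w hw)

/-- The closed cyclic subspace of the vector `ξ`. -/
abbrev cyclic (D : StarSubalgebra ℂ (B H)) (ξ : H) : Submodule ℂ H :=
  orbit (Subalgebra.toSubmodule D.toSubalgebra) ξ

lemma self_mem_cyclic (D : StarSubalgebra ℂ (B H)) (ξ : H) : ξ ∈ cyclic D ξ :=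
  apply_mem_orbit (S := 1) (one_mem D) ξ

lemma cyclic_projection_mem {D : StarSubalgebra ℂ (B H)} (hD : IsMasa D) (ξ : H) :
    (cyclic D ξ).starProjection ∈ D :=
  starProjection_mem_masa hD _ fun _ hA _ hv =>
    orbit_invariant (fun _ hS => mul_mem (S := StarSubalgebra ℂ (B H)) hA hS) ξ hv

omit [CompleteSpace H] in
lemma norm_sq_summable_map (P : B H) {x : ℕ → H} (hx : Summable fun n => ‖x n‖ ^ 2) :
    Summable fun n => ‖P (x n)‖ ^ 2 := by
  refine Summable.of_nonneg_of_le (fun n => by positivity) (fun n => ?_) (hx.mul_left (‖P‖ ^ 2))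
  rw [← mul_pow]
  gcongr
  exact P.le_opNorm _

lemma wStarContinuous_mulLeftRight (P Q : B H) :
    WStarContinuous H (mulLeftRight ℂ (B H) P Q) := by
  let _ := weakStarTopology H
  refine continuous_induced_rng.2 (continuous_pi fun ω => ?_)
  obtain ⟨ω, x, y, hx, hy, hω⟩ := ω
  let ω' : {ω : B H →ₗ[ℂ] ℂ // IsNormalFunctional H ω} :=
    ⟨ω ∘ₗ (mulLeftRight ℂ (B H) P Q : B H →ₗ[ℂ] B H), fun n => Q (x n),
      fun n => (adjoint P) (y n), norm_sq_summable_map Q hx, norm_sq_summable_map _ hy, fun T => by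
        simp [hω, adjoint_inner_left]⟩
  have h : Continuous fun (S : B H) (ω : {ω : B H →ₗ[ℂ] ℂ // IsNormalFunctional H ω}) => ω.1 S :=
    continuous_induced_dom
  exact (continuous_apply ω').comp h

lemma isSchurIdempotent_mulLeftRight {D : StarSubalgebra ℂ (B H)} (hD : IsMasa D) {P Q : B H}
    (hP : P ∈ D) (hQ : Q ∈ D) (hPP : P * P = P) (hQQ : Q * Q = Q) :
    IsSchurIdempotent D (mulLeftRight ℂ (B H) P Q) := by
  refine ⟨⟨wStarContinuous_mulLeftRight P Q, fun A hA C hC T => ?_⟩,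
    ContinuousLinearMap.ext fun T => ?_⟩
  · simp only [mulLeftRight_apply]
    rw [← mul_assoc, ← mul_assoc, hD.1 P hP A hA, mul_assoc _ C Q, hD.1 C hC Q hQ]
    simp only [mul_assoc]
  · simp only [comp_apply, mulLeftRight_apply]
    rw [← mul_assoc, ← mul_assoc, hPP, mul_assoc, hQQ]

/-- Some contractive Schur idempotent annihilating `X` detects the distance from `T ξ` to `X ξ`. -/
lemma exists_schurIdempotent_iInf_le {D : StarSubalgebra ℂ (B H)} (hD : IsMasa D)
    {X : Submodule ℂ (B H)} (hX : IsBimodule D X) (T : B H) {ξ : H} (hξ : ‖ξ‖ = 1) :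
    ∃ Φ : B H →L[ℂ] B H, IsSchurIdempotent D Φ ∧ ‖Φ‖ ≤ 1 ∧ (∀ S ∈ X, Φ S = 0) ∧
      ⨅ S : (X : Set (B H)), ‖T ξ - S.1 ξ‖ ≤ ‖Φ T‖ := by
  set R := (orbit X ξ).starProjection with hR
  set Q := (cyclic D ξ).starProjection with hQ
  have hRD : R ∈ D := starProjection_mem_masa hD _ fun A hA v hv =>
    orbit_invariant (fun S hS => by simpa using hX A hA 1 (one_mem D) S hS) ξ hv
  have hQD : Q ∈ D := cyclic_projection_mem hD ξ
  have hRR : R * R = R := Submodule.isIdempotentElem_starProjection _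
  have hQQ : Q * Q = Q := Submodule.isIdempotentElem_starProjection _
  have hQξ : Q ξ = ξ := Submodule.starProjection_eq_self_iff.2 (self_mem_cyclic D ξ)
  have hR1 : ‖1 - R‖ ≤ 1 := by
    have : (1 : B H) - R = (orbit X ξ)ᗮ.starProjection := by
      ext v; simp [hR]
    rw [this]; exact Submodule.starProjection_norm_le _
  refine ⟨mulLeftRight ℂ (B H) (1 - R) Q, isSchurIdempotent_mulLeftRight hD
    (sub_mem (one_mem D) hRD) hQD (by simp [sub_mul, mul_sub, hRR]) hQQ, ?_, fun S hS => ?_, ?_⟩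
  · calc _ ≤ ‖1 - R‖ * ‖Q‖ := opNorm_mulLeftRight_apply_apply_le ..
      _ ≤ 1 * 1 := by gcongr; exact Submodule.starProjection_norm_le _
      _ = 1 := one_mul 1
  · ext v
    have hz : ∀ w ∈ cyclic D ξ, (1 - R) (S w) = 0 := fun w hw =>
      orbit_induction (p := fun w => (1 - R) (S w) = 0)
        (isClosed_eq (by fun_prop) continuous_const)
        (fun A hA => by
          have : S (A ξ) ∈ orbit X ξ :=
            apply_mem_orbit (S := S * A) (by simpa using hX 1 (one_mem D) A hA S hS) ξ
          simp [hR, Submodule.starProjection_eq_self_iff.2 this]) hw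
    simpa using hz (Q v) (Submodule.starProjection_apply_mem _ _)
  · have hle : ‖(1 - R) (T ξ)‖ ≤ ‖mulLeftRight ℂ (B H) (1 - R) Q T‖ := by
      have := (mulLeftRight ℂ (B H) (1 - R) Q T).le_opNorm ξ
      rwa [hξ, mul_one, show mulLeftRight ℂ (B H) (1 - R) Q T ξ = (1 - R) (T (Q ξ)) from rfl,
        hQξ] at this
    refine le_trans ?_ hle
    have hb : BddBelow (Set.range fun S : (X : Set (B H)) => ‖T ξ - S.1 ξ‖) :=
      ⟨0, by rintro _ ⟨S, rfl⟩; positivity⟩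
    have hmem : R (T ξ) ∈ orbit X ξ := Submodule.starProjection_apply_mem _ _
    have key := orbit_induction
      (p := fun v => ⨅ S : (X : Set (B H)), ‖T ξ - S.1 ξ‖ ≤ ‖T ξ - v‖)
      (isClosed_le continuous_const (by fun_prop)) (fun S hS => ciInf_le hb ⟨S, hS⟩) hmem
    simpa using key

/-- An operator which is a compact perturbation of an operator of strictly smaller norm. -/
def IsGapped (T : B H) : Prop :=
  ∃ A C : B H, T = A + C ∧ ‖A‖ < ‖T‖ ∧ IsCompactOperator C

/-- The eigenspace of `T† T` for the value `‖T‖ ^ 2`, on which `T` attains its norm. -/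
def topSpace (T : B H) : Submodule ℂ H :=
  LinearMap.ker ((adjoint T * T - ((‖T‖ ^ 2 : ℝ) : ℂ) • (1 : B H) : B H) : H →ₗ[ℂ] H)

lemma mem_topSpace_iff {T : B H} {v : H} :
    v ∈ topSpace T ↔ adjoint T (T v) = ((‖T‖ ^ 2 : ℝ) : ℂ) • v := by
  rw [topSpace, LinearMap.mem_ker, ← sub_eq_zero (a := adjoint T (T v))]
  rfl

lemma inner_of_mem_topSpace {T : B H} {v : H} (hv : v ∈ topSpace T) (w : H) :
    ⟪T v, T w⟫_ℂ = ((‖T‖ ^ 2 : ℝ) : ℂ) * ⟪v, w⟫_ℂ := by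
  rw [← adjoint_inner_left, mem_topSpace_iff.1 hv, inner_smul_left, Complex.conj_ofReal]

lemma inner_of_mem_topSpace' {T : B H} {v : H} (hv : v ∈ topSpace T) (w : H) :
    ⟪T w, T v⟫_ℂ = ((‖T‖ ^ 2 : ℝ) : ℂ) * ⟪w, v⟫_ℂ := by
  rw [← adjoint_inner_right, mem_topSpace_iff.1 hv, inner_smul_right]

lemma norm_of_mem_topSpace {T : B H} {v : H} (hv : v ∈ topSpace T) : ‖T v‖ = ‖T‖ * ‖v‖ := by
  have h := inner_of_mem_topSpace hv v
  rw [inner_self_eq_norm_sq_to_K, inner_self_eq_norm_sq_to_K] at h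
  have h' : ‖T v‖ ^ 2 = ‖T‖ ^ 2 * ‖v‖ ^ 2 := by
    apply Complex.ofReal_injective
    push_cast
    simpa using h
  rw [← mul_pow] at h'
  exact (sq_eq_sq₀ (by positivity) (by positivity)).1 h'

lemma mem_topSpace_of_norm {T : B H} {v : H} (hv : ‖T v‖ = ‖T‖ * ‖v‖) : v ∈ topSpace T := by
  rw [mem_topSpace_iff, ← sub_eq_zero, ← norm_eq_zero]
  have h := norm_sub_sq (𝕜 := ℂ) (adjoint T (T v)) (((‖T‖ ^ 2 : ℝ) : ℂ) • v)
  have h1 : ⟪adjoint T (T v), ((‖T‖ ^ 2 : ℝ) : ℂ) • v⟫_ℂ = ((‖T‖ ^ 2 * ‖T v‖ ^ 2 : ℝ) : ℂ) := by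
    rw [inner_smul_right, adjoint_inner_left, inner_self_eq_norm_sq_to_K]
    push_cast; rfl
  have h2 : ‖adjoint T (T v)‖ ≤ ‖T‖ * ‖T v‖ := by
    simpa using (adjoint T).le_opNorm (T v)
  have h3 : ‖adjoint T (T v)‖ ^ 2 ≤ (‖T‖ * ‖T v‖) ^ 2 := by gcongr
  rw [h1, norm_smul, Complex.norm_real, norm_pow, norm_norm, RCLike.re_eq_complex_re,
    Complex.ofReal_re, hv] at h
  rw [hv] at h3
  have h4 : ‖adjoint T (T v) - ((‖T‖ ^ 2 : ℝ) : ℂ) • v‖ ^ 2 ≤ 0 := by rw [h]; nlinarith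
  exact pow_eq_zero_iff (two_ne_zero) |>.1 (le_antisymm h4 (by positivity))

lemma isOpen_isGapped : IsOpen {T : B H | IsGapped T} := by
  rw [isOpen_iff_mem_nhds]
  rintro T ⟨A, C, hT, hA, hC⟩
  have h : Tendsto (fun T' : B H => ‖T'‖ - ‖A + (T' - T)‖) (𝓝 T) (𝓝 (‖T‖ - ‖A + (T - T)‖)) := by
    apply Continuous.tendsto; fun_prop
  have hpos : 0 < ‖T‖ - ‖A + (T - T)‖ := by simpa using hA
  filter_upwards [h.eventually (lt_mem_nhds hpos)] with T' hT'
  exact ⟨A + (T' - T), C, by rw [hT]; abel, by linarith, hC⟩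

/-- Almost maximizing sequences of a gapped operator have convergent subsequences. -/
lemma IsGapped.exists_tendsto_subseq {T : B H} (hT : IsGapped T) {x : ℕ → H}
    (hx : ∀ n, ‖x n‖ ≤ 1)
    (hlim : Tendsto (fun n => ‖T‖ ^ 2 * ‖x n‖ ^ 2 - ‖T (x n)‖ ^ 2) atTop (𝓝 0)) :
    ∃ (ξ : H) (φ : ℕ → ℕ), StrictMono φ ∧ Tendsto (x ∘ φ) atTop (𝓝 ξ) := by
  obtain ⟨A, C, hTAC, hA, hC⟩ := hT
  obtain ⟨c, -, φ, hφ, hc⟩ := (hC.isCompact_closure_image_closedBall 1).tendsto_subseq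
    (x := fun n => C (x n))
    (fun n => subset_closure ⟨x n, by simpa using hx n, rfl⟩)
  have hcauchy : CauchySeq (x ∘ φ) := by
    rw [cauchySeq_iff_tendsto_dist_atTop_0]
    set y := x ∘ φ with hy
    have hy1 : ∀ n, ‖y n‖ ≤ 1 := fun n => hx _
    set q : ℕ → ℝ := fun n => ‖T‖ ^ 2 * ‖y n‖ ^ 2 - ‖T (y n)‖ ^ 2 with hq
    have hq0 : Tendsto q atTop (𝓝 0) := hlim.comp hφ.tendsto_atTop
    set e : ℕ × ℕ → ℝ := fun p => ‖C (y p.1) - C (y p.2)‖ with he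
    have hf1 : Tendsto (fun p : ℕ × ℕ => p.1) atTop atTop := by
      rw [← prod_atTop_atTop_eq]; exact tendsto_fst
    have hf2 : Tendsto (fun p : ℕ × ℕ => p.2) atTop atTop := by
      rw [← prod_atTop_atTop_eq]; exact tendsto_snd
    have he0 : Tendsto e atTop (𝓝 0) := by
      simpa [he, hy] using ((hc.comp hf1).sub (hc.comp hf2)).norm
    have hg : 0 < ‖T‖ ^ 2 - ‖A‖ ^ 2 := by
      have := norm_nonneg A
      nlinarith
    have hbound : ∀ p : ℕ × ℕ, dist (y p.1) (y p.2) ^ 2 ≤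
        (‖T‖ ^ 2 - ‖A‖ ^ 2)⁻¹ * (2 * q p.1 + 2 * q p.2 + 4 * ‖A‖ * e p + e p ^ 2) := by
      rintro ⟨m, n⟩
      rw [inv_mul_eq_div, le_div_iff₀ hg, dist_eq_norm]
      have par1 := parallelogram_law_with_norm ℂ (y m) (y n)
      have par2 := parallelogram_law_with_norm ℂ (T (y m)) (T (y n))
      rw [← map_add, ← map_sub] at par2
      have h1 : ‖T (y m + y n)‖ ^ 2 ≤ (‖T‖ * ‖y m + y n‖) ^ 2 := by
        gcongr; exact T.le_opNorm _
      have h2 : ‖T (y m - y n)‖ ≤ ‖A‖ * ‖y m - y n‖ + e (m, n) := by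
        calc ‖T (y m - y n)‖ = ‖A (y m - y n) + (C (y m) - C (y n))‖ := by
              rw [hTAC, add_apply, map_sub C]
          _ ≤ _ := (norm_add_le _ _).trans (by gcongr; exact A.le_opNorm _)
      have h2' : ‖T (y m - y n)‖ ^ 2 ≤ (‖A‖ * ‖y m - y n‖ + e (m, n)) ^ 2 := by gcongr
      have h3 : ‖y m - y n‖ ≤ 2 :=
        (norm_sub_le _ _).trans (by linarith [hy1 m, hy1 n])
      have h4 : 0 ≤ ‖A‖ * e (m, n) := by positivity
      have h5 := mul_le_mul_of_nonneg_left h3 h4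
      have par1' := congrArg (‖T‖ ^ 2 * ·) par1
      simp only [hq] at *
      nlinarith
    have hsq : Tendsto (fun p : ℕ × ℕ => dist (y p.1) (y p.2) ^ 2) atTop (𝓝 0) := by
      refine squeeze_zero (fun p => by positivity) hbound ?_
      have := (((((hq0.comp hf1).const_mul 2).add ((hq0.comp hf2).const_mul 2)).add
        (he0.const_mul (4 * ‖A‖))).add (he0.pow 2)).const_mul (‖T‖ ^ 2 - ‖A‖ ^ 2)⁻¹
      simpa using this
    have := hsq.sqrt
    simpa [Real.sqrt_sq dist_nonneg] using this
  obtain ⟨ξ, hξ⟩ := cauchySeq_tendsto_of_complete hcauchy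
  exact ⟨ξ, φ, hφ, hξ⟩

lemma IsGapped.exists_tendsto_topSpace {T : B H} (hT : IsGapped T) {x : ℕ → H}
    (hx : ∀ n, ‖x n‖ = 1) (hlim : Tendsto (fun n => ‖T (x n)‖) atTop (𝓝 ‖T‖)) :
    ∃ ξ ∈ topSpace T, ‖ξ‖ = 1 ∧
      ∃ φ : ℕ → ℕ, StrictMono φ ∧ Tendsto (x ∘ φ) atTop (𝓝 ξ) := by
  obtain ⟨ξ, φ, hφ, hξ⟩ := hT.exists_tendsto_subseq (fun n => (hx n).le)
    (by
    have := (hlim.pow 2).const_sub (‖T‖ ^ 2)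
    rw [sub_self] at this
    simpa [hx] using this)
  have h1 : ‖ξ‖ = 1 := tendsto_nhds_unique hξ.norm (by simp [hx])
  refine ⟨ξ, mem_topSpace_of_norm ?_, h1, φ, hφ, hξ⟩
  rw [h1, mul_one]
  exact tendsto_nhds_unique ((T.continuous.tendsto ξ).comp hξ).norm (hlim.comp hφ.tendsto_atTop)

lemma IsGapped.exists_tendsto_topSpace_of_tendsto {T : B H} (hT : IsGapped T) {U : ℕ → B H}
    (hU : Tendsto U atTop (𝓝 T)) {x : ℕ → H} (hx : ∀ n, ‖x n‖ = 1)
    (hxU : ∀ n, x n ∈ topSpace (U n)) :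
    ∃ ξ ∈ topSpace T, ‖ξ‖ = 1 ∧
      ∃ φ : ℕ → ℕ, StrictMono φ ∧ Tendsto (x ∘ φ) atTop (𝓝 ξ) := by
  refine hT.exists_tendsto_topSpace hx ?_
  have h0 : Tendsto (fun n => ‖U n - T‖) atTop (𝓝 0) := by
    simpa using (hU.sub_const T).norm
  have hle : ∀ n, |‖T (x n)‖ - ‖U n‖| ≤ ‖U n - T‖ := fun n => by
    have h := norm_of_mem_topSpace (hxU n)
    rw [hx, mul_one] at h
    rw [← h, abs_sub_comm]
    refine (abs_norm_sub_norm_le _ _).trans ?_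
    simpa [hx] using (U n - T).le_opNorm (x n)
  have := (squeeze_zero_norm hle h0).add hU.norm
  simpa using this

lemma IsGapped.exists_mem_topSpace {T : B H} (hT : IsGapped T) : ∃ ξ ∈ topSpace T, ‖ξ‖ = 1 := by
  have hpos : 0 < ‖T‖ := by
    obtain ⟨A, -, -, hA, -⟩ := hT
    exact (norm_nonneg A).trans_lt hA
  have hex : ∀ n : ℕ, ∃ x : H, ‖x‖ = 1 ∧ ‖T‖ - 1 / ((n : ℝ) + 1) ≤ ‖T x‖ := fun n => by
    obtain ⟨r, hr, hrT⟩ := exists_between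
      (show max 0 (‖T‖ - 1 / ((n : ℝ) + 1)) < ‖T‖ from
        max_lt hpos (sub_lt_self _ Nat.one_div_pos_of_nat))
    obtain ⟨x, hx, hxr⟩ := T.exists_lt_apply_of_lt_opNorm hrT
    have hx0 : 0 < ‖x‖ := by
      rw [norm_pos_iff]; rintro rfl
      rw [map_zero, norm_zero] at hxr
      linarith [le_max_left 0 (‖T‖ - 1 / ((n : ℝ) + 1))]
    refine ⟨((‖x‖⁻¹ : ℝ) : ℂ) • x, ?_, ?_⟩
    · rw [norm_smul, Complex.norm_real, norm_inv, norm_norm, inv_mul_cancel₀ hx0.ne']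
    · rw [map_smul, norm_smul, Complex.norm_real, norm_inv, norm_norm]
      have : ‖T x‖ ≤ ‖x‖⁻¹ * ‖T x‖ :=
        le_mul_of_one_le_left (norm_nonneg _) (one_le_inv₀ hx0 |>.2 hx.le)
      linarith [le_max_right 0 (‖T‖ - 1 / ((n : ℝ) + 1))]
  choose x hx hxT using hex
  obtain ⟨ξ, h, h1, -⟩ := hT.exists_tendsto_topSpace hx <| by
    refine tendsto_of_tendsto_of_tendsto_of_le_of_le
      (by simpa using (tendsto_one_div_add_atTop_nhds_zero_nat (𝕜 := ℝ)).const_sub ‖T‖)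
      tendsto_const_nhds hxT fun n => ?_
    simpa [hx] using T.le_opNorm (x n)
  exact ⟨ξ, h, h1⟩

lemma IsGapped.finiteDimensional_topSpace {T : B H} (hT : IsGapped T) :
    FiniteDimensional ℂ (topSpace T) := by
  refine FiniteDimensional.of_isCompact_closedBall ℂ (r := 1) one_pos (c := 0) ?_
  rw [isCompact_iff_isSeqCompact]
  intro x hx
  have hx1 : ∀ n, ‖(x n : H)‖ ≤ 1 := fun n => by simpa using hx n
  obtain ⟨ξ, φ, hφ, hξ⟩ := hT.exists_tendsto_subseq hx1 <| by
    simp [norm_of_mem_topSpace (x _).2, mul_pow]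
  have hclosed : IsClosed (topSpace T : Set H) := by
    exact ContinuousLinearMap.isClosed_ker
      (adjoint T * T - ((‖T‖ ^ 2 : ℝ) : ℂ) • (1 : B H) : B H)
  have hmem : ξ ∈ topSpace T := hclosed.mem_of_tendsto hξ (Eventually.of_forall fun n => (x _).2)
  refine ⟨⟨ξ, hmem⟩, ?_, φ, hφ, tendsto_subtype_rng.2 hξ⟩
  have : ‖ξ‖ ≤ 1 := le_of_tendsto' hξ.norm fun n => hx1 _
  simpa using this

open Module in
omit [CompleteSpace H] in
lemma exists_unit_mem_orthogonal {V G : Submodule ℂ H} [FiniteDimensional ℂ G]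
    (h : finrank ℂ G < finrank ℂ V) : ∃ x ∈ V, ‖x‖ = 1 ∧ x ∈ Gᗮ := by
  have := FiniteDimensional.of_finrank_pos (pos_of_gt h)
  have hker := LinearMap.ker_ne_bot_of_finrank_lt
    (f := (G.orthogonalProjectionOnto : H →ₗ[ℂ] G) ∘ₗ V.subtype) h
  obtain ⟨⟨x, hx⟩, hxk, hx0⟩ := (Submodule.ne_bot_iff _).1 hker
  have hx0' : x ≠ 0 := fun h => hx0 (Subtype.ext h)
  have hxG : x ∈ Gᗮ := by
    rw [← Submodule.orthogonalProjectionOnto_eq_zero_iff]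
    exact hxk
  exact ⟨_, V.smul_mem ((‖x‖⁻¹ : ℝ) : ℂ) hx, by
    rw [norm_smul, Complex.norm_real, norm_inv, norm_norm,
      inv_mul_cancel₀ (norm_ne_zero_iff.2 hx0')], Gᗮ.smul_mem _ hxG⟩

omit [CompleteSpace H] in
lemma exists_seq_pos_of_mem_nhds {T : B H} {s : Set (B H)} (hs : s ∈ 𝓝 T) (S : B H) :
    ∃ t : ℕ → ℝ, (∀ n, 0 < t n) ∧ Tendsto t atTop (𝓝 0) ∧
      ∀ n, T + (t n : ℂ) • S ∈ s := by
  have hu : Tendsto (fun n : ℕ => 1 / ((n : ℝ) + 1)) atTop (𝓝 0) :=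
    tendsto_one_div_add_atTop_nhds_zero_nat
  have hc : Tendsto (fun r : ℝ => T + (r : ℂ) • S) (𝓝 0) (𝓝 T) := by
    have : Continuous fun r : ℝ => T + (r : ℂ) • S := by fun_prop
    simpa using this.tendsto 0
  obtain ⟨N, hN⟩ := eventually_atTop.1 ((hc.comp hu).eventually hs)
  exact ⟨fun n => 1 / (((n + N : ℕ) : ℝ) + 1), fun n => by positivity,
    (tendsto_add_atTop_iff_nat N).2 hu, fun n => hN _ (Nat.le_add_left _ _)⟩

omit [CompleteSpace H] in
lemma tendsto_add_smul (T S : B H) {t : ℕ → ℝ} (ht : Tendsto t atTop (𝓝 0)) :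
    Tendsto (fun n => T + (t n : ℂ) • S) atTop (𝓝 T) := by
  have : Continuous fun r : ℝ => T + (r : ℂ) • S := by fun_prop
  have h := this.tendsto 0
  rw [Complex.ofReal_zero, zero_smul, add_zero] at h
  exact h.comp ht

open Module in
/-- First order perturbation of the top eigenspace: if its dimension does not drop in the
direction `S`, then `T† S + S† T` is diagonal on it. -/
lemma inner_add_inner_eq_zero {T S : B H} (hT : IsGapped T) {t : ℕ → ℝ} (ht0 : ∀ n, 0 < t n)
    (ht : Tendsto t atTop (𝓝 0))
    (hle : ∀ n, finrank ℂ (topSpace T) ≤ finrank ℂ (topSpace (T + (t n : ℂ) • S)))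
    {ζ η : H} (hζ : ζ ∈ topSpace T) (hη : η ∈ topSpace T) (hζ0 : ζ ≠ 0) (h0 : ⟪ζ, η⟫_ℂ = 0) :
    ⟪T ζ, S η⟫_ℂ + ⟪S ζ, T η⟫_ℂ = 0 := by
  have := hT.finiteDimensional_topSpace
  set G : Submodule ℂ H := topSpace T ⊓ (ℂ ∙ ζ)ᗮ with hG
  have hζζ : ⟪ζ, ζ⟫_ℂ ≠ 0 := inner_self_ne_zero.2 hζ0
  have hGlt : G < topSpace T := by
    refine lt_of_le_of_ne inf_le_left fun h => hζζ ?_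
    have : ζ ∈ G := h ▸ hζ
    exact Submodule.mem_orthogonal_singleton_iff_inner_right.1 this.2
  have : FiniteDimensional ℂ G := Submodule.finiteDimensional_of_le hGlt.le
  have hGfin := Submodule.finrank_lt_finrank_of_lt hGlt
  choose x hx hx1 hxG using fun n => exists_unit_mem_orthogonal (hGfin.trans_le (hle n))
  obtain ⟨ξ, hξ, hξ1, φ, hφ, hlim⟩ :=
    hT.exists_tendsto_topSpace_of_tendsto (tendsto_add_smul T S ht) hx1 hx
  have hξG : ξ ∈ Gᗮ := (Submodule.isClosed_orthogonal G).mem_of_tendsto hlim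
    (Eventually.of_forall fun n => hxG _)
  have hηG : η ∈ G := ⟨hη, Submodule.mem_orthogonal_singleton_iff_inner_right.2 h0⟩
  set c : ℂ := ⟪ζ, ξ⟫_ℂ / ⟪ζ, ζ⟫_ℂ with hc
  have hζw : ⟪ζ, ξ - c • ζ⟫_ℂ = 0 := by
    rw [inner_sub_right, inner_smul_right, hc, div_mul_cancel₀ _ hζζ, sub_self]
  have hw : ξ - c • ζ ∈ G := ⟨sub_mem hξ (Submodule.smul_mem _ _ hζ),
    Submodule.mem_orthogonal_singleton_iff_inner_right.2 hζw⟩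
  have hξc : ξ = c • ζ := by
    rw [← sub_eq_zero, ← inner_self_eq_zero (𝕜 := ℂ)]
    nth_rewrite 2 [sub_eq_add_neg]
    rw [inner_add_right, inner_neg_right, inner_smul_right, (Submodule.mem_orthogonal _ _).1 hξG _ hw,
      inner_eq_zero_symm.1 hζw]
    simp
  have hc0 : c ≠ 0 := by
    rintro h
    rw [hξc, h, zero_smul, norm_zero] at hξ1
    exact zero_ne_one hξ1
  have heq : ∀ n, ⟪T (x n), S η⟫_ℂ + ⟪S (x n), T η⟫_ℂ + (t n : ℂ) * ⟪S (x n), S η⟫_ℂ = 0 := by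
    intro n
    have hxη : ⟪x n, η⟫_ℂ = 0 := inner_eq_zero_symm.1 ((Submodule.mem_orthogonal _ _).1 (hxG n) _ hηG)
    have h1 := inner_of_mem_topSpace (hx n) η
    have h2 := inner_of_mem_topSpace' hη (x n)
    rw [hxη, mul_zero] at h1 h2
    simp only [add_apply, smul_apply, inner_add_left, inner_add_right, inner_smul_left,
      inner_smul_right, Complex.conj_ofReal, h2] at h1
    have ht' : (t n : ℂ) ≠ 0 := Complex.ofReal_ne_zero.2 (ht0 n).ne'
    refine mul_left_cancel₀ ht' ?_
    linear_combination h1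
  have hlim' : Tendsto (fun n => ⟪T ((x ∘ φ) n), S η⟫_ℂ + ⟪S ((x ∘ φ) n), T η⟫_ℂ +
      (t (φ n) : ℂ) * ⟪S ((x ∘ φ) n), S η⟫_ℂ) atTop
      (𝓝 (⟪T ξ, S η⟫_ℂ + ⟪S ξ, T η⟫_ℂ + ((0 : ℝ) : ℂ) * ⟪S ξ, S η⟫_ℂ)) := by
    have hTx := (T.continuous.tendsto ξ).comp hlim
    have hSx := (S.continuous.tendsto ξ).comp hlim
    exact ((hTx.inner tendsto_const_nhds).add (hSx.inner tendsto_const_nhds)).add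
      (((Complex.continuous_ofReal.tendsto 0).comp (ht.comp hφ.tendsto_atTop)).mul
        (hSx.inner tendsto_const_nhds))
  have hfin := tendsto_nhds_unique hlim' (tendsto_const_nhds.congr fun n => (heq (φ n)).symm)
  rw [Complex.ofReal_zero, zero_mul, add_zero, hξc, map_smul, map_smul, inner_smul_left,
    inner_smul_left, ← mul_add] at hfin
  exact (mul_eq_zero.1 hfin).resolve_left (by simpa using hc0)

open Module in
/-- A gapped operator in a right `D`-module can be perturbed inside the module so that it
attains its norm on a single line. -/
lemma exists_simple_topSpace {D : StarSubalgebra ℂ (B H)} (hD : IsMasa D)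
    {M : Submodule ℂ (B H)} (hM : ∀ S ∈ M, ∀ a ∈ D, S * a ∈ M) {T : B H} (hTM : T ∈ M)
    (hT : IsGapped T) {ε : ℝ} (hε : 0 < ε) :
    ∃ T' ∈ M, IsGapped T' ∧ ‖T' - T‖ < ε ∧
      ∃ ξ ∈ topSpace T', ‖ξ‖ = 1 ∧ ∀ v ∈ topSpace T', ∃ c : ℂ, v = c • ξ := by
  obtain ⟨T', ⟨hM', hT', hε'⟩, hmin⟩ := (InvImage.wf
    (fun S : B H => finrank ℂ (topSpace S)) Nat.lt_wfRel.wf).has_min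
    {S | S ∈ M ∧ IsGapped S ∧ ‖S - T‖ < ε} ⟨T, hTM, hT, by simpa using hε⟩
  have hpos : ((‖T'‖ ^ 2 : ℝ) : ℂ) ≠ 0 := by
    obtain ⟨A, -, -, hA, -⟩ := hT'
    have := (norm_nonneg A).trans_lt hA
    exact Complex.ofReal_ne_zero.2 (by positivity)
  have hfirst : ∀ S ∈ M, ∀ ζ ∈ topSpace T', ∀ η ∈ topSpace T', ζ ≠ 0 → ⟪ζ, η⟫_ℂ = 0 →
      ⟪T' ζ, S η⟫_ℂ + ⟪S ζ, T' η⟫_ℂ = 0 := by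
    intro S hS ζ hζ η hη hζ0 h0
    have hopen : {U : B H | IsGapped U ∧ ‖U - T‖ < ε} ∈ 𝓝 T' :=
      (isOpen_isGapped.inter (isOpen_lt (f := fun U : B H => ‖U - T‖) (by fun_prop)
        continuous_const)).mem_nhds ⟨hT', hε'⟩
    obtain ⟨t, ht0, ht, htm⟩ := exists_seq_pos_of_mem_nhds hopen S
    refine inner_add_inner_eq_zero hT' ht0 ht (fun n => ?_) hζ hη hζ0 h0
    exact not_lt.1 (hmin _ ⟨add_mem hM' (M.smul_mem _ hS), htm n⟩)
  have hdiag : ∀ a ∈ D, ∀ ζ ∈ topSpace T', ∀ η ∈ topSpace T', ζ ≠ 0 → ⟪ζ, η⟫_ℂ = 0 →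
      ⟪ζ, a η⟫_ℂ = 0 := by
    intro a ha ζ hζ η hη hζ0 h0
    have h1 : ⟪T' ζ, T' (a η)⟫_ℂ + ⟪T' (a ζ), T' η⟫_ℂ = 0 :=
      hfirst _ (hM _ hM' a ha) ζ hζ η hη hζ0 h0
    have h2 := hfirst _ (M.smul_mem Complex.I (hM _ hM' a ha)) ζ hζ η hη hζ0 h0
    change ⟪T' ζ, Complex.I • T' (a η)⟫_ℂ + ⟪Complex.I • T' (a ζ), T' η⟫_ℂ = 0 at h2
    rw [inner_smul_right, inner_smul_left, Complex.conj_I] at h2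
    have h3 : ⟪T' ζ, T' (a η)⟫_ℂ = 0 := by
      refine mul_left_cancel₀ (mul_ne_zero two_ne_zero Complex.I_ne_zero) ?_
      linear_combination Complex.I * h1 + h2
    rw [inner_of_mem_topSpace hζ] at h3
    exact (mul_eq_zero.1 h3).resolve_left hpos
  obtain ⟨ξ, hξ, hξ1⟩ := hT'.exists_mem_topSpace
  refine ⟨T', hM', hT', hε', ξ, hξ, hξ1, ?_⟩
  by_contra! hne
  obtain ⟨v, hv, hvc⟩ := hne
  set y := v - ⟪ξ, v⟫_ℂ • ξ with hy
  have hy0 : y ≠ 0 := sub_ne_zero.2 (hvc _)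
  have hyT : y ∈ topSpace T' := sub_mem hv (Submodule.smul_mem _ _ hξ)
  have hξξ : ⟪ξ, ξ⟫_ℂ = 1 := by
    rw [inner_self_eq_norm_sq_to_K, hξ1]; simp
  have hξy : ⟪ξ, y⟫_ℂ = 0 := by
    rw [hy, inner_sub_right, inner_smul_right, hξξ, mul_one, sub_self]
  have hyξ : ⟪y, ξ⟫_ℂ = 0 := inner_eq_zero_symm.1 hξy
  set q := (cyclic D ξ).starProjection with hq
  have hqξ : q ξ = ξ := Submodule.starProjection_eq_self_iff.2 (self_mem_cyclic D ξ)
  have hqy : q y = 0 := by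
    rw [hq, Submodule.starProjection_apply_eq_zero_iff, Submodule.mem_orthogonal']
    intro u hu
    refine orbit_induction (p := fun u => ⟪y, u⟫_ℂ = 0) (isClosed_eq (by fun_prop) (by fun_prop))
      (fun a ha => ?_) hu
    exact hdiag a ha y hyT ξ hξ hy0 hyξ
  have hyy : ⟪y, y⟫_ℂ ≠ 0 := inner_self_ne_zero.2 hy0
  have hfinal := hdiag q (cyclic_projection_mem hD ξ) (ξ + y) (add_mem hξ hyT)
    (⟪y, y⟫_ℂ • ξ - y) (sub_mem (Submodule.smul_mem _ _ hξ) hyT)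
    (fun h => by
      have : ⟪ξ, ξ + y⟫_ℂ = 0 := by rw [h, inner_zero_right]
      rw [inner_add_right, hξξ, hξy, add_zero] at this
      exact one_ne_zero this)
    (by simp only [inner_add_left, inner_sub_right, inner_smul_right, hξξ, hξy, hyξ]; ring)
  rw [map_sub, map_smul, hqξ, hqy, sub_zero, inner_smul_right, inner_add_left, hξξ, hyξ, add_zero,
    mul_one] at hfinal
  exact hyy hfinal

/-- Birkhoff-James orthogonality at an operator attaining its norm on a single line. -/
lemma inner_eq_zero_of_norm_le {T S : B H} (hT : IsGapped T) {ξ : H} (hξ1 : ‖ξ‖ = 1)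
    (hξ : ∀ v ∈ topSpace T, ∃ c : ℂ, v = c • ξ) (hmin : ∀ c : ℂ, ‖T‖ ≤ ‖T + c • S‖) :
    ⟪T ξ, S ξ⟫_ℂ = 0 := by
  set d : ℂ := ⟪T ξ, S ξ⟫_ℂ with hd
  set R : B H := (-(starRingEnd ℂ d)) • S with hR
  obtain ⟨t, ht0, ht, htg⟩ := exists_seq_pos_of_mem_nhds (isOpen_isGapped.mem_nhds hT) R
  choose x hx hx1 using fun n => (htg n).exists_mem_topSpace
  obtain ⟨ζ, hζ, hζ1, φ, hφ, hlim⟩ :=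
    hT.exists_tendsto_topSpace_of_tendsto (tendsto_add_smul T R ht) hx1 hx
  have hle : ∀ n, 0 ≤ 2 * (⟪T (x n), R (x n)⟫_ℂ).re + t n * ‖R (x n)‖ ^ 2 := by
    intro n
    have h1 : ‖T‖ ≤ ‖T + (t n : ℂ) • R‖ := by
      rw [hR, smul_smul]; exact hmin _
    have h2 := norm_of_mem_topSpace (hx n)
    rw [hx1, mul_one, add_apply, smul_apply] at h2
    have h3 := norm_add_sq (𝕜 := ℂ) (T (x n)) ((t n : ℂ) • R (x n))
    rw [h2, inner_smul_right, norm_smul, Complex.norm_real, Real.norm_of_nonneg (ht0 n).le,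
      RCLike.re_eq_complex_re, Complex.re_ofReal_mul] at h3
    have h4 : ‖T (x n)‖ ≤ ‖T‖ := by simpa [hx1] using T.le_opNorm (x n)
    have h5 : ‖T (x n)‖ ^ 2 ≤ ‖T‖ ^ 2 := by gcongr
    have h6 : ‖T‖ ^ 2 ≤ ‖T + (t n : ℂ) • R‖ ^ 2 := by gcongr
    refine nonneg_of_mul_nonneg_right (a := t n) ?_ (ht0 n)
    nlinarith
  have hnonneg : 0 ≤ 2 * (⟪T ζ, R ζ⟫_ℂ).re + 0 * ‖R ζ‖ ^ 2 := by
    have hTx := (T.continuous.tendsto ζ).comp hlim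
    have hRx := (R.continuous.tendsto ζ).comp hlim
    exact ge_of_tendsto' (((Complex.continuous_re.tendsto _).comp (hTx.inner hRx)).const_mul 2 |>.add
      ((ht.comp hφ.tendsto_atTop).mul (hRx.norm.pow 2))) fun n => hle (φ n)
  obtain ⟨c, rfl⟩ := hξ ζ hζ
  have hc : ‖c‖ = 1 := by simpa [norm_smul, hξ1] using hζ1
  have hcalc : ⟪T (c • ξ), R (c • ξ)⟫_ℂ = ((-(‖c‖ ^ 2 * ‖d‖ ^ 2) : ℝ) : ℂ) := by
    rw [hR, map_smul, map_smul, smul_apply, inner_smul_left, inner_smul_right, inner_smul_right,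
      ← hd]
    push_cast
    rw [← Complex.conj_mul', ← Complex.conj_mul']
    ring
  rw [hcalc, Complex.ofReal_re, hc] at hnonneg
  have : ‖d‖ ^ 2 ≤ 0 := by linarith
  exact norm_eq_zero.1 (pow_eq_zero_iff two_ne_zero |>.1 (le_antisymm this (by positivity)))

open InnerProductSpace (rankOne)

/-- The bounded functional `T ↦ ⟪y, T x⟫`. -/
def vecFun (y x : H) : B H →L[ℂ] ℂ := (innerSL ℂ y).comp (apply ℂ H x)

omit [CompleteSpace H] in
lemma vecFun_apply (y x : H) (T : B H) : vecFun y x T = ⟪y, T x⟫_ℂ := rfl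

lemma norm_vecFun_le (y x : H) : ‖vecFun y x‖ ≤ ‖y‖ * ‖x‖ := by
  refine opNorm_le_bound _ (by positivity) fun T => ?_
  rw [vecFun_apply]
  refine (norm_inner_le_norm _ _).trans ?_
  calc ‖y‖ * ‖T x‖ ≤ ‖y‖ * (‖T‖ * ‖x‖) := by gcongr; exact T.le_opNorm x
    _ = _ := by ring

variable (H) in
/-- The norm closed linear span of the vector functionals. -/
def normalSpace : Submodule ℂ (B H →L[ℂ] ℂ) :=
  (Submodule.span ℂ {f | ∃ y x : H, f = vecFun y x}).topologicalClosure

omit [CompleteSpace H] in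
lemma vecFun_mem_normalSpace (y x : H) : vecFun y x ∈ normalSpace H :=
  Submodule.le_topologicalClosure _ (Submodule.subset_span ⟨y, x, rfl⟩)

lemma IsNormalFunctional.exists_mem_normalSpace {ω : B H →ₗ[ℂ] ℂ}
    (hω : IsNormalFunctional H ω) : ∃ g ∈ normalSpace H, ∀ T, g T = ω T := by
  obtain ⟨x, y, hx, hy, h⟩ := hω
  have hb : ∀ n, ‖vecFun (y n) (x n)‖ ≤ ‖x n‖ ^ 2 + ‖y n‖ ^ 2 := fun n =>
    (norm_vecFun_le _ _).trans (by
      nlinarith [sq_nonneg (‖x n‖ - ‖y n‖), sq_nonneg ‖x n‖, sq_nonneg ‖y n‖])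
  have hs : Summable fun n => vecFun (y n) (x n) := Summable.of_norm_bounded (hx.add hy) hb
  refine ⟨∑' n, vecFun (y n) (x n), ?_, fun T => ?_⟩
  · exact (Submodule.isClosed_topologicalClosure _).mem_of_tendsto hs.hasSum
      (Eventually.of_forall fun s => sum_mem fun n _ => vecFun_mem_normalSpace _ _)
  · rw [h]
    exact (apply ℂ ℂ T).map_tsum hs

omit [CompleteSpace H] in
lemma isNormalFunctional_vecFun (y x : H) :
    IsNormalFunctional H (vecFun y x : B H →ₗ[ℂ] ℂ) := by
  refine ⟨Pi.single 0 x, Pi.single 0 y, ?_, ?_, fun T => ?_⟩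
  · exact summable_of_ne_finset_zero (s := {0}) fun n hn => by
      simp [Pi.single_eq_of_ne (Finset.notMem_singleton.1 hn)]
  · exact summable_of_ne_finset_zero (s := {0}) fun n hn => by
      simp [Pi.single_eq_of_ne (Finset.notMem_singleton.1 hn)]
  · rw [tsum_eq_single 0 fun n hn => by simp [Pi.single_eq_of_ne hn]]
    simp [vecFun_apply]

lemma WStarContinuous.exists_mem_normalSpace {Φ : B H →L[ℂ] B H} (hΦ : WStarContinuous H Φ)
    (y x : H) : ∃ g ∈ normalSpace H, ∀ T, g T = ⟪y, Φ T x⟫_ℂ := by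
  let f : {ω : B H →ₗ[ℂ] ℂ // IsNormalFunctional H ω} → B H →ₗ[ℂ] ℂ := Subtype.val
  let ψ : B H →ₗ[ℂ] ℂ := (vecFun y x : B H →ₗ[ℂ] ℂ) ∘ₗ (Φ : B H →ₗ[ℂ] B H)
  have htop : weakStarTopology H = ⨅ i, TopologicalSpace.induced (f i) inferInstance :=
    induced_to_pi _
  have hψ : Continuous[weakStarTopology H, inferInstance] ψ := by
    let _ := weakStarTopology H
    have h1 : Continuous fun (T : B H) (ω : {ω : B H →ₗ[ℂ] ℂ // IsNormalFunctional H ω}) =>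
      ω.1 T := continuous_induced_dom
    exact ((continuous_apply
      (⟨_, isNormalFunctional_vecFun y x⟩ : {ω : B H →ₗ[ℂ] ℂ // IsNormalFunctional H ω})).comp
        h1).comp hΦ
  rw [htop] at hψ
  have hspan := (LinearMap.mem_span_iff_continuous ψ).2 hψ
  suffices ∀ χ ∈ Submodule.span ℂ (Set.range f), ∃ g ∈ normalSpace H, ∀ T, g T = χ T from
    this ψ hspan
  intro χ hχ
  induction hχ using Submodule.span_induction with
  | mem χ h =>
    obtain ⟨ω, rfl⟩ := h
    exact ω.2.exists_mem_normalSpace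
  | zero => exact ⟨0, zero_mem _, fun T => rfl⟩
  | add χ₁ χ₂ _ _ h₁ h₂ =>
    obtain ⟨g₁, hg₁, h₁⟩ := h₁
    obtain ⟨g₂, hg₂, h₂⟩ := h₂
    exact ⟨g₁ + g₂, add_mem hg₁ hg₂, fun T => by simp [h₁, h₂]⟩
  | smul c χ _ h =>
    obtain ⟨g, hg, h⟩ := h
    exact ⟨c • g, Submodule.smul_mem _ _ hg, fun T => by simp [h]⟩

/-- A bounded functional in `normalSpace H` is approximated in norm by finite combinations of
vector functionals. -/
lemma exists_mem_span_norm_sub_lt {g : B H →L[ℂ] ℂ} (hg : g ∈ normalSpace H) {ε : ℝ}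
    (hε : 0 < ε) :
    ∃ g' ∈ Submodule.span ℂ {f | ∃ y x : H, f = vecFun y x}, ‖g - g'‖ < ε := by
  have hg' : g ∈ closure (Submodule.span ℂ {f | ∃ y x : H, f = vecFun y x} : Set _) := hg
  obtain ⟨g', h, h'⟩ := Metric.mem_closure_iff.1 hg' ε hε
  exact ⟨g', h, by rwa [← dist_eq_norm]⟩

omit [CompleteSpace H] in
lemma exists_norm_sub_apply_lt {X : Submodule ℂ (B H)} {ξ v : H} (hv : v ∈ orbit X ξ) {ε : ℝ}
    (hε : 0 < ε) : ∃ S ∈ X, ‖v - S ξ‖ < ε := by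
  have hv' : v ∈ closure ((X.map (apply ℂ H ξ : B H →ₗ[ℂ] H) : Submodule ℂ H) : Set H) := hv
  obtain ⟨_, ⟨S, hS, rfl⟩, h⟩ := Metric.mem_closure_iff.1 hv' ε hε
  exact ⟨S, hS, by rwa [← dist_eq_norm]⟩

lemma norm_star_apply {D : StarSubalgebra ℂ (B H)} (hD : IsMasa D) {a : B H} (ha : a ∈ D)
    (ξ : H) : ‖(star a) ξ‖ = ‖a ξ‖ := by
  have hcomm : a * star a = star a * a := hD.1 a ha _ (star_mem ha)
  have h1 : ‖(star a) ξ‖ ^ 2 = (⟪ξ, (a * star a) ξ⟫_ℂ).re := by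
    rw [← inner_self_eq_norm_sq (𝕜 := ℂ), RCLike.re_eq_complex_re]
    congr 1
    rw [star_eq_adjoint, adjoint_inner_left]
    rfl
  have h2 : ‖a ξ‖ ^ 2 = (⟪ξ, (star a * a) ξ⟫_ℂ).re := by
    rw [← inner_self_eq_norm_sq (𝕜 := ℂ), RCLike.re_eq_complex_re]
    congr 1
    rw [star_eq_adjoint, ← adjoint_inner_right]
    rfl
  rw [hcomm, ← h2] at h1
  exact (sq_eq_sq₀ (norm_nonneg _) (norm_nonneg _)).1 h1

omit [CompleteSpace H] in
lemma isCompactOperator_rankOne (u v : H) : IsCompactOperator (rankOne ℂ u v : B H) :=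
  (isCompactOperator_of_locallyCompactSpace_rng (toSpanSingleton ℂ u)).comp_clm (innerSL ℂ v)

lemma exists_compact_approx {D : StarSubalgebra ℂ (B H)} (hD : IsMasa D) (η ξ : H)
    {g : B H →L[ℂ] ℂ} (hg : g ∈ normalSpace H) {ε : ℝ} (hε : 0 < ε) :
    ∃ R : B H, IsCompactOperator R ∧ ∀ a ∈ D, ∀ b ∈ D,
      ‖g (rankOne ℂ ((star b) η) ((star a) ξ)) - ⟪b η, R (a ξ)⟫_ℂ‖ ≤ ε * (‖a ξ‖ * ‖b η‖) := by
  have hspan : ∀ g' ∈ Submodule.span ℂ {f | ∃ y x : H, f = vecFun y x}, ∀ ε > 0,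
      ∃ R : B H, IsCompactOperator R ∧ ∀ a ∈ D, ∀ b ∈ D,
      ‖g' (rankOne ℂ ((star b) η) ((star a) ξ)) - ⟪b η, R (a ξ)⟫_ℂ‖ ≤
        ε * (‖a ξ‖ * ‖b η‖) := by
    intro g' hg'
    induction hg' using Submodule.span_induction with
    | zero =>
      intro ε hε
      exact ⟨0, isCompactOperator_zero, fun a _ b _ => by simp; positivity⟩
    | add g₁ g₂ _ _ h₁ h₂ =>
      intro ε hε
      obtain ⟨R₁, hR₁, h₁⟩ := h₁ (ε / 2) (half_pos hε)
      obtain ⟨R₂, hR₂, h₂⟩ := h₂ (ε / 2) (half_pos hε)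
      refine ⟨R₁ + R₂, hR₁.add hR₂, fun a ha b hb => ?_⟩
      rw [add_apply, add_apply, inner_add_right, add_sub_add_comm]
      refine (norm_add_le _ _).trans ((add_le_add (h₁ a ha b hb) (h₂ a ha b hb)).trans_eq ?_)
      ring
    | smul c g' _ h =>
      intro ε hε
      obtain ⟨R, hR, h⟩ := h (ε / (‖c‖ + 1)) (by positivity)
      refine ⟨c • R, hR.smul c, fun a ha b hb => ?_⟩
      rw [smul_apply, smul_apply, inner_smul_right, smul_eq_mul, ← mul_sub, norm_mul]
      calc _ ≤ (‖c‖ + 1) * (ε / (‖c‖ + 1) * (‖a ξ‖ * ‖b η‖)) := by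
            gcongr
            · linarith
            · exact h a ha b hb
        _ = _ := by field_simp
    | mem g' h =>
      obtain ⟨y, x, rfl⟩ := h
      intro ε hε
      obtain ⟨d, hd, hdy⟩ := exists_norm_sub_apply_lt (X := Subalgebra.toSubmodule D.toSubalgebra)
        ((cyclic D η).starProjection_apply_mem y) (show 0 < ε / (2 * (‖x‖ + 1)) by positivity)
      obtain ⟨c, hc, hcx⟩ := exists_norm_sub_apply_lt (X := Subalgebra.toSubmodule D.toSubalgebra)
        ((cyclic D ξ).starProjection_apply_mem x) (show 0 < ε / (2 * (‖d η‖ + 1)) by positivity)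
      refine ⟨rankOne ℂ ((star d) η) ((star c) ξ), isCompactOperator_rankOne _ _,
        fun a ha b hb => ?_⟩
      have hη : (star b) η ∈ cyclic D η := 
        apply_mem_orbit (star_mem (S := StarSubalgebra ℂ (B H)) hb) η
      have hξ : (star a) ξ ∈ cyclic D ξ := 
        apply_mem_orbit (star_mem (S := StarSubalgebra ℂ (B H)) ha) ξ
      have e1 : ⟪y, (star b) η⟫_ℂ - ⟪d η, (star b) η⟫_ℂ =
          ⟪(cyclic D η).starProjection y - d η, (star b) η⟫_ℂ := by
        rw [inner_sub_left, Submodule.inner_starProjection_left_eq_right,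
          Submodule.starProjection_eq_self_iff.2 hη]
      have e2 : ⟪(star a) ξ, x⟫_ℂ - ⟪(star a) ξ, c ξ⟫_ℂ =
          ⟪(star a) ξ, (cyclic D ξ).starProjection x - c ξ⟫_ℂ := by
        rw [inner_sub_right, ← Submodule.inner_starProjection_left_eq_right,
          Submodule.starProjection_eq_self_iff.2 hξ]
      have e3 : ⟪b η, (star d) η⟫_ℂ = ⟪d η, (star b) η⟫_ℂ := by
        rw [star_eq_adjoint, star_eq_adjoint, adjoint_inner_right, adjoint_inner_right]
        exact congrArg (fun S : B H => ⟪S η, η⟫_ℂ) (hD.1 d hd b hb)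
      have e4 : ⟪(star c) ξ, a ξ⟫_ℂ = ⟪(star a) ξ, c ξ⟫_ℂ := by
        rw [star_eq_adjoint, star_eq_adjoint, adjoint_inner_left, adjoint_inner_left]
        exact congrArg (fun S : B H => ⟪ξ, S ξ⟫_ℂ) (hD.1 c hc a ha)
      rw [vecFun_apply, InnerProductSpace.rankOne_apply, InnerProductSpace.rankOne_apply,
        inner_smul_right, inner_smul_right, e3, e4,
        show ⟪(star a) ξ, x⟫_ℂ * ⟪y, (star b) η⟫_ℂ - ⟪(star a) ξ, c ξ⟫_ℂ * ⟪d η, (star b) η⟫_ℂ =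
          ⟪(star a) ξ, x⟫_ℂ * (⟪y, (star b) η⟫_ℂ - ⟪d η, (star b) η⟫_ℂ) +
          (⟪(star a) ξ, x⟫_ℂ - ⟪(star a) ξ, c ξ⟫_ℂ) * ⟪d η, (star b) η⟫_ℂ by ring, e1, e2]
      have n1 : ‖⟪(star a) ξ, x⟫_ℂ‖ ≤ ‖a ξ‖ * (‖x‖ + 1) := by
        refine (norm_inner_le_norm _ _).trans ?_
        rw [norm_star_apply hD ha]
        gcongr
        linarith
      have n2 : ‖⟪d η, (star b) η⟫_ℂ‖ ≤ (‖d η‖ + 1) * ‖b η‖ := by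
        refine (norm_inner_le_norm _ _).trans ?_
        rw [norm_star_apply hD hb]
        gcongr
        linarith
      have n3 : ‖⟪(cyclic D η).starProjection y - d η, (star b) η⟫_ℂ‖ ≤
          ε / (2 * (‖x‖ + 1)) * ‖b η‖ := by
        refine (norm_inner_le_norm _ _).trans ?_
        rw [norm_star_apply hD hb]
        gcongr
      have n4 : ‖⟪(star a) ξ, (cyclic D ξ).starProjection x - c ξ⟫_ℂ‖ ≤
          ‖a ξ‖ * (ε / (2 * (‖d η‖ + 1))) := by
        refine (norm_inner_le_norm _ _).trans ?_
        rw [norm_star_apply hD ha]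
        gcongr
      refine (norm_add_le _ _).trans ?_
      rw [norm_mul, norm_mul]
      calc _ ≤ ‖a ξ‖ * (‖x‖ + 1) * (ε / (2 * (‖x‖ + 1)) * ‖b η‖) +
            ‖a ξ‖ * (ε / (2 * (‖d η‖ + 1))) * ((‖d η‖ + 1) * ‖b η‖) := by gcongr
        _ = _ := by field_simp; ring
  obtain ⟨g', hg', hgg'⟩ := exists_mem_span_norm_sub_lt hg (half_pos hε)
  obtain ⟨R, hR, h⟩ := hspan g' hg' (ε / 2) (half_pos hε)
  refine ⟨R, hR, fun a ha b hb => ?_⟩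
  have h1 : ‖(g - g') (rankOne ℂ ((star b) η) ((star a) ξ))‖ ≤ ε / 2 * (‖a ξ‖ * ‖b η‖) := by
    refine ((g - g').le_opNorm _).trans ?_
    rw [InnerProductSpace.norm_rankOne, norm_star_apply hD ha, norm_star_apply hD hb,
      mul_comm ‖b η‖]
    gcongr
  calc _ = ‖(g - g') (rankOne ℂ ((star b) η) ((star a) ξ)) +
        (g' (rankOne ℂ ((star b) η) ((star a) ξ)) - ⟪b η, R (a ξ)⟫_ℂ)‖ := by
        rw [sub_apply]; congr 1; ring
    _ ≤ _ := (norm_add_le _ _).trans (add_le_add h1 (h a ha b hb))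
    _ = _ := by ring

lemma mul_rankOne_mul (A C : B H) (η ξ : H) :
    A * rankOne ℂ η ξ * C = rankOne ℂ (A η) ((star C) ξ) := by
  ext z
  change A (⟪ξ, C z⟫_ℂ • η) = ⟪(star C) ξ, z⟫_ℂ • A η
  rw [map_smul, star_eq_adjoint, adjoint_inner_left]

omit [CompleteSpace H] in
lemma norm_le_of_inner_le {S : B H} {K L : Submodule ℂ H} [K.HasOrthogonalProjection]
    [L.HasOrthogonalProjection] (hS : K.starProjection * S * L.starProjection = S) {ε : ℝ}
    (hε : 0 ≤ ε) (h : ∀ u ∈ K, ∀ w ∈ L, ‖⟪u, S w⟫_ℂ‖ ≤ ε * (‖w‖ * ‖u‖)) : ‖S‖ ≤ ε := by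
  refine opNorm_le_bound _ hε fun v => ?_
  have hv : S v = K.starProjection (S (L.starProjection v)) := (DFunLike.congr_fun hS v).symm
  have hmem : S v ∈ K := hv ▸ K.starProjection_apply_mem _
  have hv' : S (L.starProjection v) = S v := by
    conv_rhs => rw [← hS]
    conv_lhs => rw [← hS]
    change K.starProjection (S (L.starProjection (L.starProjection v))) =
      K.starProjection (S (L.starProjection v))
    rw [Submodule.starProjection_eq_self_iff.2 (L.starProjection_apply_mem v)]
  have h1 := h _ hmem _ (L.starProjection_apply_mem v)
  rw [hv', inner_self_eq_norm_sq_to_K, norm_pow, RCLike.norm_ofReal, abs_norm] at h1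
  have h2 : ‖L.starProjection v‖ ≤ ‖v‖ := L.norm_starProjection_apply_le v
  rcases (norm_nonneg (S v)).eq_or_lt' with h0 | h0
  · rw [h0]; positivity
  · refine le_of_mul_le_mul_right ?_ h0
    calc ‖S v‖ * ‖S v‖ ≤ ε * (‖L.starProjection v‖ * ‖S v‖) := by rw [← sq]; exact h1
      _ ≤ ε * (‖v‖ * ‖S v‖) := by gcongr
      _ = _ := by ring

/-- Schur multipliers map rank one operators to compact operators. -/
lemma IsSchurMultiplier.isCompactOperator_rankOne {D : StarSubalgebra ℂ (B H)} (hD : IsMasa D)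
    {Φ : B H →L[ℂ] B H} (hΦ : IsSchurMultiplier D Φ) (η ξ : H) :
    IsCompactOperator (Φ (rankOne ℂ η ξ)) := by
  obtain ⟨g, hg, hgΦ⟩ := hΦ.1.exists_mem_normalSpace η ξ
  set S := Φ (rankOne ℂ η ξ) with hS
  set P := (cyclic D η).starProjection with hP
  set Q := (cyclic D ξ).starProjection with hQ
  have hPD : P ∈ D := cyclic_projection_mem hD η
  have hQD : Q ∈ D := cyclic_projection_mem hD ξ
  have hPP : P * P = P := (cyclic D η).isIdempotentElem_starProjection
  have hQQ : Q * Q = Q := (cyclic D ξ).isIdempotentElem_starProjection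
  have hPSQ : P * S * Q = S := by
    rw [hS, ← hΦ.2 P hPD Q hQD, mul_rankOne_mul, hP,
      Submodule.starProjection_eq_self_iff.2 (self_mem_cyclic D η),
      (isSelfAdjoint_starProjection (cyclic D ξ)).star_eq,
      Submodule.starProjection_eq_self_iff.2 (self_mem_cyclic D ξ)]
  have hform : ∀ a ∈ D, ∀ b ∈ D,
      g (rankOne ℂ ((star b) η) ((star a) ξ)) = ⟪b η, S (a ξ)⟫_ℂ := by
    intro a ha b hb
    rw [hgΦ, ← mul_rankOne_mul, hΦ.2 _ (star_mem hb) a ha, star_eq_adjoint]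
    exact adjoint_inner_right _ _ _
  have hclosed : IsClosed {S : B H | IsCompactOperator S} := isClosed_setOfPred_isCompactOperator
  suffices h : S ∈ closure {S : B H | IsCompactOperator S} by
    rw [hclosed.closure_eq] at h
    exact h
  refine Metric.mem_closure_iff.2 fun ε hε => ?_
  obtain ⟨R, hR, hRg⟩ := exists_compact_approx hD η ξ hg (half_pos hε)
  refine ⟨P * R * Q, (hR.clm_comp P).comp_clm Q, ?_⟩
  rw [dist_eq_norm]
  refine lt_of_le_of_lt ?_ (half_lt_self hε)
  refine norm_le_of_inner_le (K := cyclic D η) (L := cyclic D ξ) ?_ (half_pos hε).le ?_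
  · rw [← hP, ← hQ, mul_sub, sub_mul, hPSQ]
    congr 1
    rw [← mul_assoc, ← mul_assoc, hPP, mul_assoc, hQQ]
  · intro u hu
    refine orbit_induction (p := fun u => ∀ w ∈ cyclic D ξ,
      ‖⟪u, (S - P * R * Q) w⟫_ℂ‖ ≤ ε / 2 * (‖w‖ * ‖u‖)) ?_ (fun b hb => ?_) hu
    · simp only [Set.ofPred_forall]
      exact isClosed_iInter fun w => isClosed_iInter fun _ =>
        isClosed_le (by fun_prop) (by fun_prop)
    · intro w hw
      refine orbit_induction (p := fun w =>
        ‖⟪b η, (S - P * R * Q) w⟫_ℂ‖ ≤ ε / 2 * (‖w‖ * ‖b η‖))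
        (isClosed_le (by fun_prop) (by fun_prop)) (fun a ha => ?_) hw
      have hb' : P (b η) = b η :=
        Submodule.starProjection_eq_self_iff.2 (apply_mem_orbit hb η)
      have ha' : Q (a ξ) = a ξ :=
        Submodule.starProjection_eq_self_iff.2 (apply_mem_orbit ha ξ)
      have hR' : ⟪b η, (P * R * Q) (a ξ)⟫_ℂ = ⟪b η, R (a ξ)⟫_ℂ := by
        change ⟪b η, P (R (Q (a ξ)))⟫_ℂ = _
        rw [ha', hP, ← Submodule.inner_starProjection_left_eq_right, ← hP, hb']
      rw [sub_apply, inner_sub_right, hR', ← hform a ha b hb]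
      exact hRg a ha b hb

lemma exists_finiteDimensional_approx (T : B H) {g : B H →L[ℂ] ℂ} (hg : g ∈ normalSpace H)
    {ε : ℝ} (hε : 0 < ε) : ∃ (K : Submodule ℂ H) (_ : FiniteDimensional ℂ K),
      ‖g (T * K.starProjection) - g T‖ ≤ ε := by
  have hspan : ∀ g' ∈ Submodule.span ℂ {f | ∃ y x : H, f = vecFun y x},
      ∃ (K : Submodule ℂ H) (_ : FiniteDimensional ℂ K), ∀ (L : Submodule ℂ H)
        [FiniteDimensional ℂ L], K ≤ L → g' (T * L.starProjection) = g' T := by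
    intro g' hg'
    induction hg' using Submodule.span_induction with
    | mem g' h =>
      obtain ⟨y, x, rfl⟩ := h
      refine ⟨ℂ ∙ x, inferInstance, fun L _ hL => ?_⟩
      rw [vecFun_apply, vecFun_apply]
      change ⟪y, T (L.starProjection x)⟫_ℂ = _
      rw [Submodule.starProjection_eq_self_iff.2 (hL (Submodule.mem_span_singleton_self x))]
    | zero => exact ⟨⊥, inferInstance, fun L _ _ => rfl⟩
    | add g₁ g₂ _ _ h₁ h₂ =>
      obtain ⟨K₁, _, h₁⟩ := h₁
      obtain ⟨K₂, _, h₂⟩ := h₂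
      refine ⟨K₁ ⊔ K₂, inferInstance, fun L _ hL => ?_⟩
      rw [add_apply, add_apply, h₁ L (le_sup_left.trans hL), h₂ L (le_sup_right.trans hL)]
    | smul c g' _ h =>
      obtain ⟨K, hK, h⟩ := h
      exact ⟨K, hK, fun L _ hL => by rw [smul_apply, smul_apply, h L hL]⟩
  obtain ⟨g', hg', hgg'⟩ := exists_mem_span_norm_sub_lt hg
    (show 0 < ε / (2 * (‖T‖ + 1)) by positivity)
  obtain ⟨K, hK, h⟩ := hspan g' hg'
  refine ⟨K, hK, ?_⟩
  have hTK : ‖T * K.starProjection‖ ≤ ‖T‖ :=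
    (norm_mul_le _ _).trans (mul_le_of_le_one_right (norm_nonneg _) K.starProjection_norm_le)
  have h1 : ‖(g - g') (T * K.starProjection - T)‖ ≤ ε / (2 * (‖T‖ + 1)) * (2 * (‖T‖ + 1)) := by
    refine ((g - g').le_opNorm _).trans ?_
    have : ‖T * K.starProjection - T‖ ≤ 2 * (‖T‖ + 1) :=
      (norm_sub_le _ _).trans (by linarith)
    gcongr
  rw [div_mul_cancel₀ _ (by positivity)] at h1
  rwa [map_sub, sub_apply, sub_apply, h K le_rfl, sub_sub_sub_cancel_right] at h1

lemma IsSchurMultiplier.isCompactOperator_mul_starProjection {D : StarSubalgebra ℂ (B H)}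
    (hD : IsMasa D) {Φ : B H →L[ℂ] B H} (hΦ : IsSchurMultiplier D Φ) (T : B H)
    (K : Submodule ℂ H) [FiniteDimensional ℂ K] :
    IsCompactOperator (Φ (T * K.starProjection)) := by
  have h : T * K.starProjection = ∑ i, rankOne ℂ
      (T (stdOrthonormalBasis ℂ K i)) (stdOrthonormalBasis ℂ K i : H) := by
    rw [(stdOrthonormalBasis ℂ K).starProjection_eq_sum_rankOne, Finset.mul_sum]
    refine Finset.sum_congr rfl fun i _ => ?_
    exact InnerProductSpace.comp_rankOne _ _ _
  rw [h, map_sum]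
  exact Submodule.sum_mem (compactOperator (RingHom.id ℂ) H H)
    fun i _ => hΦ.isCompactOperator_rankOne hD _ _

lemma norm_apply_le_norm (Φ : B H →L[ℂ] B H) (hΦ : ‖Φ‖ ≤ 1) (T : B H) : ‖Φ T‖ ≤ ‖T‖ :=
  (Φ.le_opNorm T).trans (mul_le_of_le_one_left (norm_nonneg T) hΦ)

/-- An operator in the range of a contractive Schur idempotent is a norm limit of gapped operators
in that range. -/
lemma exists_gapped_near {D : StarSubalgebra ℂ (B H)} (hD : IsMasa D) {Φ : B H →L[ℂ] B H}
    (hΦ : IsSchurMultiplier D Φ) (hΦ1 : ‖Φ‖ ≤ 1) {T : B H} (hT : Φ T = T) (hT0 : T ≠ 0)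
    {δ : ℝ} (hδ : 0 < δ) :
    ∃ R : B H, IsGapped (T + Φ R) ∧ ‖Φ R‖ ≤ δ := by
  have hN : 0 < ‖T‖ := norm_pos_iff.2 hT0
  set t : ℝ := δ / ‖T‖ with ht
  have ht0 : 0 < t := by positivity
  set s : ℝ := t * ‖T‖ / (1 + 2 * t) with hs
  have hs0 : 0 < s := by positivity
  have hst : s * (1 + 2 * t) = t * ‖T‖ := div_mul_cancel₀ _ (by positivity)
  have hsN : s < ‖T‖ := by nlinarith
  obtain ⟨x, hx, hxT⟩ := T.exists_lt_apply_of_lt_opNorm (sub_lt_self ‖T‖ hs0)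
  have hTx : 0 < ‖T x‖ := by linarith
  set η : H := ((‖T x‖⁻¹ : ℝ) : ℂ) • T x with hη
  have hη1 : ‖η‖ = 1 := by
    rw [hη, norm_smul, Complex.norm_real, norm_inv, norm_norm, inv_mul_cancel₀ hTx.ne']
  have hηT : ⟪η, T x⟫_ℂ = (‖T x‖ : ℂ) := by
    rw [hη, inner_smul_left, Complex.conj_ofReal, inner_self_eq_norm_sq_to_K]
    have : (‖T x‖ : ℂ) ≠ 0 := Complex.ofReal_ne_zero.2 hTx.ne'
    push_cast
    field_simp
    rfl
  obtain ⟨g, hg, hgΦ⟩ := hΦ.1.exists_mem_normalSpace η x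
  obtain ⟨K, hK, hKg⟩ := exists_finiteDimensional_approx T hg hs0
  have hC := hΦ.isCompactOperator_mul_starProjection hD T K
  set R := T * K.starProjection with hR
  have hRN : ‖Φ R‖ ≤ ‖T‖ := (norm_apply_le_norm Φ hΦ1 R).trans <|
    (norm_mul_le _ _).trans (mul_le_of_le_one_right (norm_nonneg _) K.starProjection_norm_le)
  have hmap : Φ ((t : ℂ) • R) = (t : ℂ) • Φ R := map_smul _ _ _
  refine ⟨(t : ℂ) • R, ⟨T, Φ ((t : ℂ) • R), rfl, ?_, ?_⟩, ?_⟩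
  · have h1 : ‖(⟪η, Φ R x⟫_ℂ - (‖T x‖ : ℂ))‖ ≤ s := by
      rw [← hηT]
      conv_lhs => rw [← hT]
      rw [← hgΦ, ← hgΦ]
      exact hKg
    have h2 := (Complex.abs_re_le_norm _).trans h1
    rw [Complex.sub_re, Complex.ofReal_re, abs_le] at h2
    have h3 : (⟪η, (T + Φ ((t : ℂ) • R)) x⟫_ℂ).re = ‖T x‖ + t * (⟪η, Φ R x⟫_ℂ).re := by
      rw [hmap, add_apply, smul_apply, inner_add_right, inner_smul_right, hηT, Complex.add_re,
        Complex.ofReal_re, Complex.re_ofReal_mul]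
    have h4 : (⟪η, (T + Φ ((t : ℂ) • R)) x⟫_ℂ).re ≤ ‖T + Φ ((t : ℂ) • R)‖ := by
      refine (Complex.re_le_norm _).trans ((norm_inner_le_norm _ _).trans ?_)
      rw [hη1, one_mul]
      exact ((T + Φ ((t : ℂ) • R)).le_opNorm x).trans
        (mul_le_of_le_one_right (norm_nonneg _) hx.le)
    have h5 : t * (‖T‖ - 2 * s) ≤ t * (⟪η, Φ R x⟫_ℂ).re := by
      gcongr
      linarith [h2.1]
    linarith
  · rw [hmap]
    exact hC.smul (t : ℂ)
  · rw [hmap, norm_smul, Complex.norm_real, Real.norm_of_nonneg ht0.le]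
    calc t * ‖Φ R‖ ≤ t * ‖T‖ := by gcongr
      _ = δ := div_mul_cancel₀ _ hN.ne'

lemma exists_unit_norm_le_norm_sub {D : StarSubalgebra ℂ (B H)} (hD : IsMasa D)
    {Φ : B H →L[ℂ] B H} (hΦ : IsSchurIdempotent D Φ) (hΦ1 : ‖Φ‖ ≤ 1) {T : B H} (hT : Φ T = T)
    (hT0 : T ≠ 0) {δ : ℝ} (hδ : 0 < δ) :
    ∃ ξ : H, ‖ξ‖ = 1 ∧ ∀ S : B H, Φ S = 0 → ‖T‖ - δ ≤ ‖T ξ - S ξ‖ := by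
  obtain ⟨R, hgap, hRδ⟩ := exists_gapped_near hD hΦ.1 hΦ1 hT hT0 (show 0 < δ / 4 by positivity)
  set M : Submodule ℂ (B H) := LinearMap.range (Φ : B H →ₗ[ℂ] B H) with hM
  have hMD : ∀ S ∈ M, ∀ a ∈ D, S * a ∈ M := by
    rintro _ ⟨S, rfl⟩ a ha
    refine ⟨1 * S * a, ?_⟩
    exact (hΦ.1.2 1 (one_mem D) a ha S).trans (by rw [one_mul]; rfl)
  have hTM : T + Φ R ∈ M := add_mem ⟨T, hT⟩ ⟨R, rfl⟩
  obtain ⟨U, ⟨V, hV⟩, hU, hUδ, ξ, hξ, hξ1, hsimple⟩ :=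
    exists_simple_topSpace hD hMD hTM hgap (show 0 < δ / 4 by positivity)
  have hΦU : Φ U = U := by
    rw [← hV]
    exact DFunLike.congr_fun hΦ.2 V
  refine ⟨ξ, hξ1, fun S hS => ?_⟩
  have horth : ⟪U ξ, S ξ⟫_ℂ = 0 := by
    refine inner_eq_zero_of_norm_le hU hξ1 hsimple fun c => ?_
    have h := norm_apply_le_norm Φ hΦ1 (U + c • S)
    rwa [map_add, map_smul, hS, smul_zero, add_zero, hΦU] at h
  have h1 : ‖U‖ ≤ ‖U ξ - S ξ‖ := by
    have h := norm_sub_sq (𝕜 := ℂ) (U ξ) (S ξ)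
    rw [horth, norm_of_mem_topSpace hξ, hξ1, mul_one, map_zero, mul_zero, sub_zero] at h
    exact (sq_le_sq₀ (norm_nonneg _) (norm_nonneg _)).1 (by rw [h]; linarith [sq_nonneg ‖S ξ‖])
  have h2 : ‖U - T‖ ≤ δ / 2 := by
    calc ‖U - T‖ = ‖(U - (T + Φ R)) + Φ R‖ := by congr 1; abel
      _ ≤ _ := norm_add_le _ _
      _ ≤ δ / 2 := by linarith
  have h3 : ‖U ξ - S ξ‖ ≤ ‖U - T‖ + ‖T ξ - S ξ‖ := by
    calc ‖U ξ - S ξ‖ = ‖(U - T) ξ + (T ξ - S ξ)‖ := by congr 1; rw [sub_apply]; abel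
      _ ≤ _ := norm_add_le _ _
      _ ≤ _ := by gcongr; simpa [hξ1] using (U - T).le_opNorm ξ
  have h4 : ‖T‖ ≤ ‖U‖ + ‖U - T‖ := by
    calc ‖T‖ = ‖U - (U - T)‖ := by congr 1; abel
      _ ≤ _ := norm_sub_le _ _
  linarith

omit [CompleteSpace H] in
lemma bddAbove_range_iInf (T : B H) (X : Submodule ℂ (B H)) :
    BddAbove (Set.range fun ξ : {ξ : H // ‖ξ‖ = 1} =>
      ⨅ S : (X : Set (B H)), ‖T ξ.1 - S.1 ξ.1‖) := by
  refine ⟨‖T‖, ?_⟩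
  rintro _ ⟨ξ, rfl⟩
  refine (ciInf_le ⟨0, ?_⟩ (⟨0, X.zero_mem⟩ : (X : Set (B H)))).trans ?_
  · rintro _ ⟨S, rfl⟩
    exact norm_nonneg _
  · simpa [ξ.2] using T.le_opNorm ξ.1

lemma norm_apply_le_arveson {D : StarSubalgebra ℂ (B H)} (hD : IsMasa D) {Φ : B H →L[ℂ] B H}
    (hΦ : IsSchurIdempotent D Φ) (hΦ1 : ‖Φ‖ ≤ 1) {X : Submodule ℂ (B H)}
    (hX : ∀ S ∈ X, Φ S = 0) (T : B H) : ‖Φ T‖ ≤ arveson T (X : Set (B H)) := by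
  have hidem : ∀ S, Φ (Φ S) = Φ S := DFunLike.congr_fun hΦ.2
  by_cases h0 : Φ T = 0
  · rw [h0, norm_zero]
    exact Real.iSup_nonneg fun ξ => Real.iInf_nonneg fun S => norm_nonneg _
  · refine le_of_forall_pos_sub_le fun δ hδ => ?_
    obtain ⟨ξ, hξ1, hξ⟩ := exists_unit_norm_le_norm_sub hD hΦ hΦ1 (hidem T) h0 hδ
    have : Nonempty (X : Set (B H)) := ⟨0, X.zero_mem⟩
    refine le_trans (le_ciInf fun S => ?_) (le_ciSup (bddAbove_range_iInf T X) ⟨ξ, hξ1⟩)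
    have h := hξ (S.1 - (T - Φ T)) (by
      rw [map_sub, map_sub, hidem, hX S.1 S.2, sub_self, sub_zero])
    refine h.trans_eq ?_
    congr 1
    simp only [sub_apply]
    abel

end SchurHyper

open SchurHyper

/-- For a weak* closed `D`-bimodule `X` and `T ∈ B(H)`, the Arveson
distance `α(T, X)` equals the supremum of `‖Φ(T)‖` over all contractive Schur
idempotents `Φ` annihilating `X`. -/
theorem stmt0 {H : Type*} [NormedAddCommGroup H] [InnerProductSpace ℂ H] [CompleteSpace H]
    [TopologicalSpace.SeparableSpace H]
    (D : StarSubalgebra ℂ (B H)) (hD : IsMasa D)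
    (X : Submodule ℂ (B H)) (hXbim : IsBimodule D X)
    (hXcl : WStarClosed H (X : Set (B H))) (T : B H) :
    arveson T (X : Set (B H)) =
      sSup {r : ℝ | ∃ Φ : B H →L[ℂ] B H, IsSchurIdempotent D Φ ∧ ‖Φ‖ ≤ 1 ∧
        (∀ S ∈ X, Φ S = 0) ∧ r = ‖Φ T‖} := by
  refine le_antisymm (Real.iSup_le (fun ξ => ?_) (Real.sSup_nonneg ?_)) (Real.sSup_le ?_ ?_)
  · obtain ⟨Φ, hΦ, hΦ1, hΦX, h⟩ := exists_schurIdempotent_iInf_le hD hXbim T ξ.2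
    refine h.trans (le_csSup ⟨‖T‖, ?_⟩ ⟨Φ, hΦ, hΦ1, hΦX, rfl⟩)
    rintro _ ⟨Ψ, -, hΨ1, -, rfl⟩
    exact norm_apply_le_norm Ψ hΨ1 T
  · rintro _ ⟨Φ, -, -, -, rfl⟩
    exact norm_nonneg _
  · rintro _ ⟨Φ, hΦ, hΦ1, hΦX, rfl⟩
    exact norm_apply_le_arveson hD hΦ hΦ1 hΦX T
  · exact Real.iSup_nonneg fun ξ => Real.iInf_nonneg fun S => norm_nonneg _
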